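/- arXiv:2510.12005 — 9 statements merged into one kernel-verified Lean document; each statement's English description precedes it below -/
import Mathlib

section
/- For every field K, every n ∈ ℕ, and every matrix A ∈ K^{n×n}, there exists an invertible matrix Q ∈ K^{n×n} such that Q⁻¹ A Q is almost upper-triangular; that is, for all indices i, j, if i > j + 1 then (Q⁻¹ A Q)_{i,j} = 0. -/
open Module in
/-- For an endomorphism `f` of a vector space of dimension at least `m`, there are `m` linearly
independent vectors each of which, except possibly the last, is mapped by `f` into the span of the
vectors up to its successor. -/
theorem exists_linearIndependent_map_mem_span_image_le {K V : Type*} [Field K] [AddCommGroup V]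
    [Module K V] [FiniteDimensional K V] (f : V →ₗ[K] V) (m : ℕ) (hm : m ≤ finrank K V) :
    ∃ v : Fin m → V, LinearIndependent K v ∧
      ∀ i j : Fin m, (j : ℕ) + 1 = i → f (v j) ∈ Submodule.span K (v '' {k | k ≤ i}) := by
  induction m with
  | zero => exact ⟨Fin.elim0, linearIndependent_empty_type, fun i => i.elim0⟩
  | succ m ih =>
    obtain ⟨v, hv, hf⟩ := ih (by omega)
    obtain ⟨w, hw, hfw⟩ : ∃ w, w ∉ Submodule.span K (Set.range v) ∧ ∀ j : Fin m,
        (j : ℕ) + 1 = m → f (v j) ∈ Submodule.span K (insert w (Set.range v)) := by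
      by_cases h : ∃ j : Fin m, (j : ℕ) + 1 = m ∧ f (v j) ∉ Submodule.span K (Set.range v)
      · obtain ⟨j, hj, hjv⟩ := h
        refine ⟨f (v j), hjv, fun k hk => ?_⟩
        obtain rfl : k = j := Fin.ext (by omega)
        exact Submodule.subset_span (Set.mem_insert _ _)
      · push Not at h
        have hlt : Submodule.span K (Set.range v) < ⊤ := by
          refine lt_top_iff_ne_top.2 fun htop => ?_
          have := finrank_span_eq_card hv
          rw [htop, finrank_top, Fintype.card_fin] at this
          omega
        obtain ⟨w, -, hw⟩ := SetLike.exists_of_lt hlt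
        exact ⟨w, hw, fun j hj => Submodule.span_mono (Set.subset_insert _ _) (h j hj)⟩
    refine ⟨Fin.snoc v w, linearIndependent_finSnoc.2 ⟨hv, hw⟩, fun i j hij => ?_⟩
    obtain ⟨j, rfl⟩ : ∃ k : Fin m, j = k.castSucc :=
      ⟨⟨j, by omega⟩, rfl⟩
    rw [Fin.snoc_castSucc (α := fun _ => V)]
    induction i using Fin.lastCases with
    | last =>
      refine Submodule.span_mono ?_ (hfw j (by simpa using hij))
      rintro x (rfl | ⟨k, rfl⟩)
      · exact ⟨Fin.last m, Fin.le_last _, by simp⟩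
      · exact ⟨k.castSucc, Fin.le_last _, by simp⟩
    | cast i =>
      refine Submodule.span_mono ?_ (hf i j (by simpa using hij))
      rintro x ⟨k, hk, rfl⟩
      exact ⟨k.castSucc, by simpa using hk, by simp⟩

/-- For every field K, every n, and every matrix A ∈ K^{n×n}, there is
an invertible Q ∈ K^{n×n} such that Q⁻¹ A Q is almost upper-triangular: all entries
strictly below the first subdiagonal vanish. -/
theorem stmt_2 (K : Type) [Field K] (n : ℕ) (A : Matrix (Fin n) (Fin n) K) :
    ∃ Q : Matrix (Fin n) (Fin n) K, IsUnit Q ∧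
      ∀ i j : Fin n, (j : ℕ) + 1 < (i : ℕ) → (Q⁻¹ * A * Q) i j = 0 := by
  obtain ⟨v, hv, hA⟩ :=
    exists_linearIndependent_map_mem_span_image_le (Matrix.toLin' A) n (by simp)
  let Q : Matrix (Fin n) (Fin n) K := Matrix.of fun i j => v j i
  have hQ : IsUnit Q := Matrix.linearIndependent_cols_iff_isUnit.1 hv
  refine ⟨Q, hQ, fun i j hij => ?_⟩
  have hspan : Submodule.span K (v '' {k | k ≤ ⟨j + 1, by omega⟩}) ≤
      LinearMap.ker (LinearMap.proj i ∘ₗ Matrix.toLin' Q⁻¹) := by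
    refine Submodule.span_le.2 ?_
    rintro x ⟨k, hk, rfl⟩
    have hki : i ≠ k := by
      rintro rfl
      exact absurd (Fin.le_def.1 hk) (not_le.2 hij)
    change (Q⁻¹ * Q) i k = 0
    rw [Matrix.nonsing_inv_mul Q ((Matrix.isUnit_iff_isUnit_det Q).1 hQ), Matrix.one_apply_ne hki]
  rw [Matrix.mul_assoc]
  exact hspan (hA ⟨j + 1, by omega⟩ j rfl)
end

section
/- Let n ≥ 1, let V be a finite set with |V| = n, and let ε : E → V × V be an assignment of (ordered pairs of) endpoints to a set E of exactly n edges (so the data is a multigraph on n vertices with n edges, in which loops and parallel edges are allowed). Then there exist bijections τ : {1,…,n} → V (a vertex ordering) and σ : {1,…,n} → E (an edge ordering) such that: (a) for every k ∈ {1,…,n} and every j ∈ {1,…,n} with j ≤ k − 2, neither endpoint of the edge σ(k) equals τ(j); and (b) for every j ∈ {1,…,n}, every edge e ∈ E having τ(j) as one of its endpoints satisfies σ⁻¹(e) ≤ j + 2. -/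
open Classical in
/-- The edges both of whose endpoints lie in `S`. -/
noncomputable def edgesInside {V E : Type*} [Fintype E] (ε : E → V × V) (S : Finset V) :
    Finset E :=
  {e | (ε e).1 ∈ S ∧ (ε e).2 ∈ S}

theorem mem_edgesInside {V E : Type*} [Fintype E] {ε : E → V × V} {S : Finset V} {e : E} :
    e ∈ edgesInside ε S ↔ (ε e).1 ∈ S ∧ (ε e).2 ∈ S := by
  simp [edgesInside]

open Classical in
/-- Some vertex can be removed while keeping at least as many edges as vertices minus one:
a vertex of minimum degree works, since the degrees sum to at most twice the number of edges. -/
theorem exists_card_le_card_edgesInside_erase {V E : Type*} [Fintype E] (ε : E → V × V)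
    (S : Finset V) (hS : S.Nonempty) (h : S.card ≤ (edgesInside ε S).card + 1) :
    ∃ v ∈ S, (S.erase v).card ≤ (edgesInside ε (S.erase v)).card + 1 := by
  by_contra! hcon
  set A := edgesInside ε S with hA
  have hpos := hS.card_pos
  have hdeg : ∀ v ∈ S, A.card + 3 ≤
      (A.filter fun e => v = (ε e).1 ∨ v = (ε e).2).card + S.card := by
    intro v hv
    have h1 := hcon v hv
    have h2 := Finset.card_filter_add_card_filter_not (s := A)
      (fun e => v = (ε e).1 ∨ v = (ε e).2)
    have h3 : A.filter (fun e => ¬(v = (ε e).1 ∨ v = (ε e).2)) ⊆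
        edgesInside ε (S.erase v) := by
      intro e he
      simp only [hA, Finset.mem_filter, mem_edgesInside, Finset.mem_erase] at he ⊢
      grind
    have h4 := Finset.card_le_card h3
    rw [Finset.card_erase_of_mem hv] at h1
    omega
  have hsum : ∑ v ∈ S, (A.filter fun e => v = (ε e).1 ∨ v = (ε e).2).card ≤ A.card * 2 := by
    have hswap := Finset.sum_card_bipartiteAbove_eq_sum_card_bipartiteBelow (s := S) (t := A)
      (fun v e => v = (ε e).1 ∨ v = (ε e).2)
    unfold Finset.bipartiteAbove Finset.bipartiteBelow at hswap
    rw [hswap, ← smul_eq_mul]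
    refine Finset.sum_le_card_nsmul _ _ _ fun e _ => ?_
    refine (Finset.card_le_card (t := {(ε e).1, (ε e).2}) fun v hv => ?_).trans
      Finset.card_le_two
    simpa using (Finset.mem_filter.1 hv).2
  obtain ⟨v, hv⟩ := hS
  have hle := Finset.card_le_card
    (Finset.filter_subset (fun e => v = (ε e).1 ∨ v = (ε e).2) A)
  have hv3 := hdeg v hv
  obtain ⟨d, hd⟩ : ∃ d, A.card + 3 = d + S.card := ⟨A.card + 3 - S.card, by omega⟩
  have hlow : S.card * d ≤ A.card * 2 := by
    rw [← smul_eq_mul]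
    refine (Finset.card_nsmul_le_sum _ _ _ fun w hw => ?_).trans hsum
    have := hdeg w hw
    omega
  obtain ⟨m, hm⟩ : ∃ m, S.card = m + 2 := ⟨S.card - 2, by omega⟩
  obtain ⟨c, rfl⟩ : ∃ c, d = c + 2 := ⟨d - 2, by omega⟩
  rw [hm] at hlow hd
  nlinarith [Nat.zero_le (m * c)]

open Classical in
/-- The vertices of `S` can be listed so that every suffix of the list spans at least
its length minus one edges. -/
theorem exists_list_suffix_length_le {V E : Type*} [Fintype E] (ε : E → V × V)
    (S : Finset V) (h : S.card ≤ (edgesInside ε S).card + 1) :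
    ∃ l : List V, l.Nodup ∧ l.toFinset = S ∧
      ∀ t, t <:+ l → t.length ≤ (edgesInside ε t.toFinset).card + 1 := by
  induction S using Finset.strongInduction with
  | H S ih =>
    rcases S.eq_empty_or_nonempty with rfl | hS
    · exact ⟨[], by simp⟩
    · obtain ⟨v, hv, hcard⟩ := exists_card_le_card_edgesInside_erase ε S hS h
      obtain ⟨l, hl, hlS, ht⟩ := ih _ (Finset.erase_ssubset hv) hcard
      have hvl : v ∉ l := by
        rw [← List.mem_toFinset, hlS]
        simp
      have hnd : (v :: l).Nodup := List.nodup_cons.2 ⟨hvl, hl⟩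
      have hS' : (v :: l).toFinset = S := by
        rw [List.toFinset_cons, hlS, Finset.insert_erase hv]
      refine ⟨v :: l, hnd, hS', fun t hsuf => ?_⟩
      rcases List.suffix_cons_iff.1 hsuf with rfl | hsuf
      · rwa [← List.toFinset_card_of_nodup hnd, hS']
      · exact ht t hsuf


/-- For a multigraph given by ε : E → V × V on n vertices with n edges
(n ≥ 1), there are orderings τ of the vertices and σ of the edges such that
(a) for k and j with j ≤ k − 2 (0-based: j + 2 ≤ k), neither endpoint of σ(k) is τ(j), and
(b) every edge incident to τ(j) appears at position ≤ j + 2 in the edge ordering. -/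
theorem stmt_3 (n : ℕ) (hn : 1 ≤ n) (V E : Type) [Fintype V] [Fintype E]
    (hV : Fintype.card V = n) (hE : Fintype.card E = n) (ε : E → V × V) :
    ∃ (τ : Fin n ≃ V) (σ : Fin n ≃ E),
      (∀ k j : Fin n, (j : ℕ) + 2 ≤ (k : ℕ) →
        (ε (σ k)).1 ≠ τ j ∧ (ε (σ k)).2 ≠ τ j) ∧
      (∀ j : Fin n, ∀ e : E, ((ε e).1 = τ j ∨ (ε e).2 = τ j) →
        ((σ.symm e : ℕ) ≤ (j : ℕ) + 2)) := by
  classical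
  obtain ⟨l, hl, hlV, hsuf⟩ := exists_list_suffix_length_le ε Finset.univ (by
    have : edgesInside ε Finset.univ = Finset.univ := by
      ext e
      simp [mem_edgesInside]
    rw [this, Finset.card_univ, Finset.card_univ]
    omega)
  have hlen : l.length = n := by
    rw [← List.toFinset_card_of_nodup hl, hlV, Finset.card_univ, hV]
  subst hlen
  have hmem : ∀ v, v ∈ l := fun v => by
    rw [← List.mem_toFinset, hlV]
    exact Finset.mem_univ v
  let τ : Fin l.length ≃ V := hl.getEquivOfForallMemList l hmem
  have hτ : ∀ i, τ i = l[i] := fun i => rfl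
  let σ₀ : Fin l.length ≃ E := (Fintype.equivFinOfCardEq hE).symm
  let rank : E → Fin l.length := fun e => min (τ.symm (ε e).1) (τ.symm (ε e).2)
  let σ : Fin l.length ≃ E := (Tuple.sort (rank ∘ σ₀)).trans σ₀
  have hmono : Monotone (rank ∘ σ) := Tuple.monotone_sort (rank ∘ σ₀)
  have hrank : ∀ (e : E) (j : Fin l.length), (ε e).1 = τ j ∨ (ε e).2 = τ j → rank e ≤ j := by
    rintro e j (h | h)
    · exact (min_le_left _ _).trans (by simp [h])
    · exact (min_le_right _ _).trans (by simp [h])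
  have hdrop : ∀ (v : V) (j : Fin l.length), v ∈ l.drop (j + 1) → j < τ.symm v := by
    intro v j hv
    obtain ⟨i, hi, rfl⟩ := List.mem_iff_getElem.1 hv
    rw [List.length_drop] at hi
    have : τ.symm (l.drop (j + 1))[i] = ⟨j + 1 + i, by omega⟩ := by
      rw [Equiv.symm_apply_eq, hτ]
      simp
    rw [this, Fin.lt_def]
    simp only
    omega
  have hcount : ∀ j : Fin l.length, (Finset.univ.filter fun e => rank e ≤ j).card ≤ j + 2 := by
    intro j
    have h1 := hsuf _ (List.drop_suffix (j + 1) l)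
    rw [List.length_drop] at h1
    have h2 : Disjoint (Finset.univ.filter fun e => rank e ≤ j)
        (edgesInside ε (l.drop (j + 1)).toFinset) := by
      rw [Finset.disjoint_left]
      intro e he hin
      rw [mem_edgesInside, List.mem_toFinset, List.mem_toFinset] at hin
      exact (lt_min (hdrop _ j hin.1) (hdrop _ j hin.2)).not_ge (Finset.mem_filter.1 he).2
    have h3 := Finset.card_le_univ
      ((Finset.univ.filter fun e => rank e ≤ j) ∪ edgesInside ε (l.drop (j + 1)).toFinset)
    rw [Finset.card_union_of_disjoint h2, hE] at h3
    omega
  have hpos : ∀ k j : Fin l.length, (ε (σ k)).1 = τ j ∨ (ε (σ k)).2 = τ j →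
      (k : ℕ) ≤ j + 1 := by
    intro k j h
    have hsub : (Finset.Iic k).map σ.toEmbedding ⊆ Finset.univ.filter fun e => rank e ≤ j := by
      intro e he
      obtain ⟨i, hi, rfl⟩ := Finset.mem_map.1 he
      exact Finset.mem_filter.2
        ⟨Finset.mem_univ _, (hmono (Finset.mem_Iic.1 hi)).trans (hrank _ j h)⟩
    have h1 := (Finset.card_le_card hsub).trans (hcount j)
    rw [Finset.card_map, Fin.card_Iic] at h1
    omega
  refine ⟨τ, σ, fun k j hkj => ⟨fun h => ?_, fun h => ?_⟩, fun j e he => ?_⟩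
  · have := hpos k j (Or.inl h)
    omega
  · have := hpos k j (Or.inr h)
    omega
  · have := hpos (σ.symm e) j (by rwa [Equiv.apply_symm_apply])
    omega
end

section
/- There exists N ∈ ℕ such that for all n ≥ N, for every function f : GF(2)^n → GF(2)^n and every x ∈ GF(2)^n, there exist an invertible matrix Q ∈ GF(2)^{n×n} and a matrix H ∈ GF(2)^{h×n}, where h = ⌈2·log₂ n⌉, such that no x' ∈ GF(2)^n conflicts with x with respect to (f, Q, H); i.e., (Q, H) is conflict-avoiding for f on input x. -/
/-- Inputs x, x' conflict with respect to (f, Q, H): f(x') ≠ f(x), H f(x') = H f(x),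
and for some i, (Q f(x'))_j = (Q f(x))_j for all j ≤ i while (Q x')_j = (Q x)_j for
all j > i. -/
def Conflicts (n h : ℕ) (f : (Fin n → ZMod 2) → (Fin n → ZMod 2))
    (Q : Matrix (Fin n) (Fin n) (ZMod 2)) (H : Matrix (Fin h) (Fin n) (ZMod 2))
    (x x' : Fin n → ZMod 2) : Prop :=
  f x' ≠ f x ∧ H.mulVec (f x') = H.mulVec (f x) ∧
    ∃ i : Fin n,
      (∀ j : Fin n, j ≤ i → Q.mulVec (f x') j = Q.mulVec (f x) j) ∧
      (∀ j : Fin n, i < j → Q.mulVec x' j = Q.mulVec x j)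

/-- A nonzero vector over `ZMod 2` is orthogonal to exactly half of all vectors. -/
theorem two_mul_card_filter_dotProduct_eq_zero {κ : Type*} [Fintype κ] [DecidableEq κ]
    {v : κ → ZMod 2} (hv : v ≠ 0) :
    2 * (Finset.univ.filter fun r : κ → ZMod 2 => r ⬝ᵥ v = 0).card = 2 ^ Fintype.card κ := by
  obtain ⟨k, hk⟩ := Function.ne_iff.mp hv
  have hk1 : v k = 1 := (by decide : ∀ a : ZMod 2, a ≠ 0 → a = 1) _ hk
  have hswap : (Finset.univ.filter fun r : κ → ZMod 2 => r ⬝ᵥ v = 0).card =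
      (Finset.univ.filter fun r : κ → ZMod 2 => ¬ r ⬝ᵥ v = 0).card := by
    refine Finset.card_equiv (Equiv.addRight (Pi.single k 1)) fun r => ?_
    simp only [Finset.mem_filter, Finset.mem_univ, true_and, Equiv.coe_addRight, add_dotProduct,
      single_dotProduct, hk1, mul_one]
    exact (by decide : ∀ a : ZMod 2, a = 0 ↔ ¬ a + 1 = 0) _
  have htotal := Finset.card_filter_add_card_filter_not (s := Finset.univ)
    (fun r : κ → ZMod 2 => r ⬝ᵥ v = 0)
  rw [← hswap, Finset.card_univ, Fintype.card_fun, ZMod.card] at htotal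
  omega

/-- The families of rows `M` with each `M j` orthogonal to a prescribed nonzero vector `v j` are
a fraction `2 ^ (-|ι|)` of all families. -/
theorem two_pow_mul_card_filter_forall_dotProduct_eq_zero {ι κ : Type*} [Fintype ι]
    [DecidableEq ι] [Fintype κ] [DecidableEq κ] {v : ι → κ → ZMod 2} (hv : ∀ j, v j ≠ 0) :
    2 ^ Fintype.card ι *
      (Finset.univ.filter fun M : ι → κ → ZMod 2 => ∀ j, M j ⬝ᵥ v j = 0).card =
      (2 ^ Fintype.card κ) ^ Fintype.card ι := by
  have hpi : (Finset.univ.filter fun M : ι → κ → ZMod 2 => ∀ j, M j ⬝ᵥ v j = 0) =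
      Fintype.piFinset fun j => Finset.univ.filter fun r : κ → ZMod 2 => r ⬝ᵥ v j = 0 := by
    ext M
    simp [Fintype.mem_piFinset]
  rw [hpi, Fintype.card_piFinset, ← Finset.card_univ, ← Finset.prod_const,
    ← Finset.prod_mul_distrib]
  simp [two_mul_card_filter_dotProduct_eq_zero (hv _)]

/-- A lower bound for the finite Euler products at `1 / 2`. -/
theorem quarter_le_prod_one_sub_half_pow (n : ℕ) :
    (1 / 4 : ℝ) + (1 / 2) ^ (n + 2) ≤ ∏ k ∈ Finset.range (n + 1), (1 - (1 / 2 : ℝ) ^ (k + 1)) := by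
  induction n with
  | zero => norm_num
  | succ n ih =>
    rw [Finset.prod_range_succ]
    have hpos : (0 : ℝ) < (1 / 2) ^ n := by positivity
    have hle : (1 / 2 : ℝ) ^ n ≤ 1 := pow_le_one₀ (by norm_num) (by norm_num)
    have hstep := mul_le_mul_of_nonneg_right ih
      (show (0 : ℝ) ≤ 1 - (1 / 2) ^ (n + 1 + 1) by rw [pow_succ, pow_succ]; linarith)
    refine le_trans ?_ hstep
    simp only [pow_succ]
    nlinarith

/-- At least a quarter of all square matrices over `ZMod 2` are invertible. -/
theorem two_pow_le_four_mul_card_GL (n : ℕ) :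
    (2 ^ n) ^ n ≤ 4 * Fintype.card (GL (Fin n) (ZMod 2)) := by
  rw [← Nat.card_eq_fintype_card, Matrix.card_GL_field, ZMod.card]
  rcases n with _ | n
  · simp
  have hprod : ((∏ i : Fin (n + 1), (2 ^ (n + 1) - 2 ^ (i : ℕ)) : ℕ) : ℝ) =
      (2 ^ (n + 1)) ^ (n + 1) * ∏ k ∈ Finset.range (n + 1), (1 - (1 / 2 : ℝ) ^ (k + 1)) := by
    rw [Fin.prod_univ_eq_prod_range (fun i => 2 ^ (n + 1) - 2 ^ i) (n + 1),
      ← Finset.prod_range_reflect (fun k => 1 - (1 / 2 : ℝ) ^ (k + 1)), Nat.cast_prod]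
    conv_rhs => rw [← Finset.card_range (n + 1), ← Finset.prod_const, Finset.card_range]
    rw [← Finset.prod_mul_distrib]
    refine Finset.prod_congr rfl fun i hi => ?_
    have hi' : i < n + 1 := Finset.mem_range.mp hi
    obtain ⟨m, rfl⟩ := Nat.exists_eq_add_of_le (Nat.lt_succ_iff.mp hi')
    rw [Nat.cast_sub (Nat.pow_le_pow_right (by norm_num) hi'.le)]
    have hm : i + m + 1 - 1 - i + 1 = m + 1 := by omega
    rw [hm, mul_sub, mul_one, add_assoc i m 1]
    have hcancel : (2 : ℝ) ^ (m + 1) * (1 / 2) ^ (m + 1) = 1 := by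
      rw [← mul_pow]
      norm_num
    push_cast
    rw [pow_add 2 i (m + 1), mul_assoc _ _ ((1 / 2 : ℝ) ^ _), hcancel, mul_one]
  have hbound := quarter_le_prod_one_sub_half_pow n
  have hpos : (0 : ℝ) < (1 / 2) ^ (n + 2) := by positivity
  have hreal : (((2 ^ (n + 1)) ^ (n + 1) : ℕ) : ℝ) ≤
      ((4 * ∏ i : Fin (n + 1), (2 ^ (n + 1) - 2 ^ (i : ℕ)) : ℕ) : ℝ) := by
    rw [Nat.cast_mul, hprod]
    push_cast
    nlinarith [show (0 : ℝ) < (2 ^ (n + 1)) ^ (n + 1) by positivity]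
  exact_mod_cast hreal

/-- The vectors orthogonal to the rows of `Q` and `H` when `x + d` conflicts with `x` at
coordinate `i`, where `y` is the difference of the two values of `f`. -/
def conflictVectors {n h : ℕ} (y d : Fin n → ZMod 2) (i : Fin n) :
    Fin n ⊕ Fin h → Fin n → ZMod 2 :=
  Sum.elim (fun j => if j ≤ i then y else d) fun _ => y

theorem conflictVectors_ne_zero {n h : ℕ} {y d : Fin n → ZMod 2} (hy : y ≠ 0) (hd : d ≠ 0)
    (i : Fin n) (j : Fin n ⊕ Fin h) : conflictVectors y d i j ≠ 0 := by
  rcases j with j | j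
  · simp only [conflictVectors, Sum.elim_inl]
    split_ifs <;> assumption
  · exact hy

theorem Conflicts.exists_dotProduct_eq_zero {n h : ℕ}
    {f : (Fin n → ZMod 2) → (Fin n → ZMod 2)} {Q : Matrix (Fin n) (Fin n) (ZMod 2)}
    {H : Matrix (Fin h) (Fin n) (ZMod 2)} {x x' : Fin n → ZMod 2}
    (hc : Conflicts n h f Q H x x') :
    ∃ i, ∀ j, Sum.elim Q H j ⬝ᵥ conflictVectors (f x' - f x) (x' - x) i j = 0 := by
  obtain ⟨-, hH, i, hle, hlt⟩ := hc
  refine ⟨i, ?_⟩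
  rintro (j | j)
  · simp only [conflictVectors, Sum.elim_inl]
    split_ifs with hj
    · rw [dotProduct_sub, sub_eq_zero]
      exact hle j hj
    · rw [dotProduct_sub, sub_eq_zero]
      exact hlt j (not_le.mp hj)
  · simp only [conflictVectors, Sum.elim_inr]
    rw [dotProduct_sub, sub_eq_zero]
    exact congrFun hH j

/-- If every pair of an invertible `Q` and an `H` has a conflict with `x`, then `h` is small. -/
theorem two_pow_le_of_forall_exists_conflicts {n h : ℕ}
    (f : (Fin n → ZMod 2) → (Fin n → ZMod 2)) (x : Fin n → ZMod 2)
    (hall : ∀ (Q : Matrix (Fin n) (Fin n) (ZMod 2)) (H : Matrix (Fin h) (Fin n) (ZMod 2)),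
      IsUnit Q → ∃ x', Conflicts n h f Q H x x') :
    2 ^ h ≤ 4 * n := by
  classical
  let bad (p : (Fin n → ZMod 2) × Fin n) : Finset (Fin n ⊕ Fin h → Fin n → ZMod 2) :=
    Finset.univ.filter fun M => ∀ j, M j ⬝ᵥ conflictVectors (f p.1 - f x) (p.1 - x) p.2 j = 0
  let P : Finset ((Fin n → ZMod 2) × Fin n) := Finset.univ.filter fun p => f p.1 ≠ f x
  have hbad : ∀ p ∈ P, 2 ^ (n + h) * (bad p).card = (2 ^ n) ^ (n + h) := by
    intro p hp
    have hf : f p.1 ≠ f x := (Finset.mem_filter.mp hp).2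
    have hx : p.1 ≠ x := fun hx => hf (congrArg f hx)
    simpa only [Fintype.card_sum, Fintype.card_fin] using
      two_pow_mul_card_filter_forall_dotProduct_eq_zero (conflictVectors_ne_zero (h := h)
        (sub_ne_zero.mpr hf) (sub_ne_zero.mpr hx) p.2)
  have hunion : 2 ^ (n + h) * (P.biUnion bad).card ≤ 2 ^ n * n * (2 ^ n) ^ (n + h) := by
    calc 2 ^ (n + h) * (P.biUnion bad).card
        ≤ 2 ^ (n + h) * ∑ p ∈ P, (bad p).card := Nat.mul_le_mul_left _ Finset.card_biUnion_le
      _ = P.card * (2 ^ n) ^ (n + h) := by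
          rw [Finset.mul_sum, Finset.sum_congr rfl hbad, Finset.sum_const, smul_eq_mul]
      _ ≤ 2 ^ n * n * (2 ^ n) ^ (n + h) := by
          refine Nat.mul_le_mul_right _ ((Finset.card_le_univ P).trans_eq ?_)
          simp
  have hgood : Fintype.card (GL (Fin n) (ZMod 2)) * (2 ^ n) ^ h ≤ (P.biUnion bad).card := by
    let e (q : GL (Fin n) (ZMod 2) × (Fin h → Fin n → ZMod 2)) :
        Fin n ⊕ Fin h → Fin n → ZMod 2 := Sum.elim (q.1 : Matrix _ _ _) q.2
    have hmem : ∀ q ∈ Finset.univ, e q ∈ P.biUnion bad := by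
      intro q _
      obtain ⟨x', hc⟩ := hall q.1 q.2 q.1.isUnit
      obtain ⟨i, hi⟩ := hc.exists_dotProduct_eq_zero
      exact Finset.mem_biUnion.mpr ⟨(x', i), Finset.mem_filter.mpr ⟨Finset.mem_univ _, hc.1⟩,
        Finset.mem_filter.mpr ⟨Finset.mem_univ _, hi⟩⟩
    have hinj : Function.Injective e := by
      intro q q' hq
      refine Prod.ext (Units.ext ?_) ?_
      · exact funext fun j => congrFun hq (Sum.inl j)
      · exact funext fun j => congrFun hq (Sum.inr j)
    have hcard := Finset.card_le_card_of_injOn e hmem hinj.injOn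
    simpa using hcard
  have hGL := two_pow_le_four_mul_card_GL n
  refine Nat.le_of_mul_le_mul_left (c := 2 ^ n * (2 ^ n) ^ (n + h)) ?_ (by positivity)
  calc 2 ^ n * (2 ^ n) ^ (n + h) * 2 ^ h
      = 2 ^ (n + h) * ((2 ^ n) ^ n * (2 ^ n) ^ h) := by ring
    _ ≤ 2 ^ (n + h) * (4 * Fintype.card (GL (Fin n) (ZMod 2)) * (2 ^ n) ^ h) := by gcongr
    _ = 4 * (2 ^ (n + h) * (Fintype.card (GL (Fin n) (ZMod 2)) * (2 ^ n) ^ h)) := by ring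
    _ ≤ 4 * (2 ^ (n + h) * (P.biUnion bad).card) := by gcongr
    _ ≤ 4 * (2 ^ n * n * (2 ^ n) ^ (n + h)) := by gcongr
    _ = 2 ^ n * (2 ^ n) ^ (n + h) * (4 * n) := by ring

/-- For all sufficiently large n, for every f : GF(2)^n → GF(2)^n and
every x, there exist an invertible Q and an H ∈ GF(2)^{⌈2 log₂ n⌉ × n} such that no x'
conflicts with x; i.e. (Q, H) is conflict-avoiding for f on input x. -/
theorem stmt_5 :
    ∃ N : ℕ, ∀ n : ℕ, N ≤ n →
      ∀ f : (Fin n → ZMod 2) → (Fin n → ZMod 2), ∀ x : Fin n → ZMod 2,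
        ∃ (Q : Matrix (Fin n) (Fin n) (ZMod 2))
          (H : Matrix (Fin (Nat.clog 2 (n ^ 2))) (Fin n) (ZMod 2)),
          IsUnit Q ∧
          ∀ x' : Fin n → ZMod 2, ¬ Conflicts n (Nat.clog 2 (n ^ 2)) f Q H x x' := by
  refine ⟨5, fun n hn f x => ?_⟩
  by_contra! hcon
  have hle : n ^ 2 ≤ 4 * n :=
    (Nat.le_pow_clog one_lt_two _).trans (two_pow_le_of_forall_exists_conflicts f x hcon)
  nlinarith
end

section
/- For every n ≥ 2, every function f : GF(2)^n → GF(2)^n, and every x ∈ GF(2)^n, the number of pairs (Q, H), where Q ∈ GF(2)^{n×n} is invertible, H ∈ GF(2)^{h×n} with h = ⌈2·log₂ n⌉, and some x' ∈ GF(2)^n conflicts with x with respect to (f, Q, H), is at most 2^n · n · 2^{h(n−1)} · 2^{n(n−1)}. -/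
/-- A nonzero vector of GF(2)^n is orthogonal to exactly 2^(n-1) vectors. -/
theorem card_dotProduct_eq_zero {n : ℕ} {a : Fin n → ZMod 2} (ha : a ≠ 0) :
    Nat.card {r : Fin n → ZMod 2 // r ⬝ᵥ a = 0} = 2 ^ (n - 1) := by
  let φ : Module.Dual (ZMod 2) (Fin n → ZMod 2) := dotProductEquiv (ZMod 2) (Fin n) a
  have hφ : φ ≠ 0 := (LinearEquiv.map_ne_zero_iff _).2 ha
  have hrank := Module.Dual.finrank_ker_add_one_of_ne_zero hφ
  rw [Module.finrank_fin_fun] at hrank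
  have hker : {r : Fin n → ZMod 2 // r ⬝ᵥ a = 0} ≃ LinearMap.ker φ :=
    Equiv.subtypeEquivRight fun r => by
      rw [LinearMap.mem_ker, dotProduct_comm]
      rfl
  rw [Nat.card_congr hker, Module.natCard_eq_pow_finrank (K := ZMod 2), Nat.card_zmod,
    ← Nat.eq_sub_of_add_eq hrank]

/-- The number of matrices over GF(2) whose rows are orthogonal to prescribed nonzero vectors. -/
theorem card_matrix_dotProduct_eq_zero {m n : ℕ} {a : Fin m → Fin n → ZMod 2}
    (ha : ∀ j, a j ≠ 0) :
    Nat.card {M : Matrix (Fin m) (Fin n) (ZMod 2) // ∀ j, M j ⬝ᵥ a j = 0} =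
      2 ^ (m * (n - 1)) := by
  have e : {M : Matrix (Fin m) (Fin n) (ZMod 2) // ∀ j, M j ⬝ᵥ a j = 0} ≃
      ∀ j, {r : Fin n → ZMod 2 // r ⬝ᵥ a j = 0} :=
    Equiv.subtypePiEquivPi (p := fun j r => r ⬝ᵥ a j = 0)
  rw [Nat.card_congr e, Nat.card_pi,
    Finset.prod_congr rfl fun j _ => card_dotProduct_eq_zero (ha j), Finset.prod_const,
    Finset.card_univ, Fintype.card_fin, ← pow_mul, mul_comm]

theorem mulVec_apply_eq_iff_dotProduct_sub {m n : ℕ} (M : Matrix (Fin m) (Fin n) (ZMod 2))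
    (u v : Fin n → ZMod 2) (j : Fin m) :
    M.mulVec u j = M.mulVec v j ↔ M j ⬝ᵥ (u - v) = 0 := by
  rw [dotProduct_sub, sub_eq_zero]
  rfl

/-- For n ≥ 2, f and x, the number of pairs (Q, H) with Q invertible for
which some x' conflicts with x is at most 2^n · n · 2^{h(n−1)} · 2^{n(n−1)},
where h = ⌈2 log₂ n⌉. -/
theorem stmt_6 (n : ℕ) (hn : 2 ≤ n)
    (f : (Fin n → ZMod 2) → (Fin n → ZMod 2)) (x : Fin n → ZMod 2) :
    Nat.card {p : Matrix (Fin n) (Fin n) (ZMod 2) ×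
        Matrix (Fin (Nat.clog 2 (n ^ 2))) (Fin n) (ZMod 2) //
        IsUnit p.1 ∧ ∃ x' : Fin n → ZMod 2,
          Conflicts n (Nat.clog 2 (n ^ 2)) f p.1 p.2 x x'} ≤
      2 ^ n * n * 2 ^ (Nat.clog 2 (n ^ 2) * (n - 1)) * 2 ^ (n * (n - 1)) := by
  classical
  set h := Nat.clog 2 (n ^ 2)
  let a (x' : Fin n → ZMod 2) (i j : Fin n) : Fin n → ZMod 2 :=
    if j ≤ i then f x' - f x else x' - x
  let A (k : {x' // f x' ≠ f x} × Fin n) :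
      Set (Matrix (Fin n) (Fin n) (ZMod 2) × Matrix (Fin h) (Fin n) (ZMod 2)) :=
    {Q | ∀ j, Q j ⬝ᵥ a k.1 k.2 j = 0} ×ˢ {H | ∀ j, H j ⬝ᵥ (f k.1 - f x) = 0}
  have hA (k) : (A k).ncard = 2 ^ (n * (n - 1)) * 2 ^ (h * (n - 1)) := by
    obtain ⟨⟨x', hx'⟩, i⟩ := k
    have hf : f x' - f x ≠ 0 := sub_ne_zero.2 hx'
    have ha (j) : a x' i j ≠ 0 := by
      by_cases hj : j ≤ i
      · simpa [a, hj] using hf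
      · simpa [a, hj, sub_eq_zero] using fun hxx : x' = x => hx' (congrArg f hxx)
    rw [Set.ncard_prod]
    exact congrArg₂ (· * ·) (card_matrix_dotProduct_eq_zero ha)
      (card_matrix_dotProduct_eq_zero fun _ => hf)
  have hcover : {p : Matrix (Fin n) (Fin n) (ZMod 2) × Matrix (Fin h) (Fin n) (ZMod 2) |
      IsUnit p.1 ∧ ∃ x', Conflicts n h f p.1 p.2 x x'} ⊆ ⋃ k, A k := by
    rintro ⟨Q, H⟩ ⟨-, x', hne, hH, i, hle, hlt⟩
    refine Set.mem_iUnion.2 ⟨(⟨x', hne⟩, i), fun j => ?_, fun j => ?_⟩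
    · by_cases hj : j ≤ i
      · simpa [a, hj] using (mulVec_apply_eq_iff_dotProduct_sub Q _ _ j).1 (hle j hj)
      · simpa [a, hj] using
          (mulVec_apply_eq_iff_dotProduct_sub Q _ _ j).1 (hlt j (not_le.1 hj))
    · exact (mulVec_apply_eq_iff_dotProduct_sub H _ _ j).1 (congrFun hH j)
  have hindex : Fintype.card ({x' // f x' ≠ f x} × Fin n) ≤ 2 ^ n * n := by
    rw [Fintype.card_prod, Fintype.card_fin]
    gcongr
    exact (Fintype.card_subtype_le _).trans_eq (by simp)
  calc
    _ ≤ (⋃ k, A k).ncard := Set.ncard_le_ncard hcover (Set.toFinite _)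
    _ ≤ ∑ k, (A k).ncard := Set.ncard_iUnion_le_of_fintype A
    _ = Fintype.card ({x' // f x' ≠ f x} × Fin n) *
          (2 ^ (n * (n - 1)) * 2 ^ (h * (n - 1))) := by simp [hA]
    _ ≤ 2 ^ n * n * (2 ^ (n * (n - 1)) * 2 ^ (h * (n - 1))) := by gcongr
    _ = _ := by ring
end

section
/- Fix d ∈ ℕ and s, u ∈ {0,1}^d. Then the number of strings t ∈ {0,1}^d such that u lies on the bit-fixing path from s to t is at most 2^{d − Δ(s,u)}, where Δ(s,u) denotes the Hamming distance between s and u. -/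
/-- For s, u ∈ {0,1}^d, the number of strings t ∈ {0,1}^d such that u
lies on the bit-fixing path from s to t (u agrees with t on the first i coordinates
and with s on the rest, for some i ∈ {0,…,d}) is at most 2^{d − Δ(s,u)}, where Δ is
the Hamming distance. -/
theorem stmt_7 (d : ℕ) (s u : Fin d → Bool) :
    Nat.card {t : Fin d → Bool //
        ∃ i : ℕ, i ≤ d ∧ ∀ j : Fin d,
          ((j : ℕ) < i → u j = t j) ∧ (i ≤ (j : ℕ) → u j = s j)} ≤
      2 ^ (d - hammingDist s u) := by
  have hcard : Nat.card ({j : Fin d // s j = u j} → Bool) = 2 ^ (d - hammingDist s u) := by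
    have h := Finset.card_filter_add_card_filter_not (s := Finset.univ) (fun j => s j = u j)
    rw [Finset.card_univ, Fintype.card_fin] at h
    rw [Nat.card_eq_fintype_card, Fintype.card_fun, Fintype.card_bool, Fintype.card_subtype,
      hammingDist]
    congr 1
    simp only [ne_eq]
    omega
  rw [← hcard]
  -- Such a `t` agrees with `u` wherever `s` and `u` differ, so it is determined elsewhere.
  refine Nat.card_le_card_of_injective (fun t j => t.1 j.1) ?_
  rintro ⟨t, i, _, ht⟩ ⟨t', i', _, ht'⟩ h
  ext1
  funext j
  by_cases hj : s j = u j
  · exact congrFun h ⟨j, hj⟩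
  · have hi : (j : ℕ) < i := not_le.mp fun hle => hj ((ht j).2 hle).symm
    have hi' : (j : ℕ) < i' := not_le.mp fun hle => hj ((ht' j).2 hle).symm
    exact ((ht j).1 hi).symm.trans ((ht' j).1 hi')
end

section
/- Fix d, k ∈ ℕ, s ∈ {0,1}^d, and a finite set B ⊆ {0,1}^d such that every u ∈ B has Hamming distance at least k from s. Then the number of strings t ∈ {0,1}^d for which the bit-fixing path from s to t contains some element of B is at most |B| · 2^{d−k}. -/
/-- If `u` agrees with `s` from coordinate `i` on, then it differs from `s` in at most `i`
coordinates. -/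
theorem hammingDist_le_of_eq_above {α : Type*} [DecidableEq α] {d i : ℕ} {s u : Fin d → α}
    (h : ∀ j : Fin d, i ≤ (j : ℕ) → u j = s j) : hammingDist s u ≤ i := by
  calc hammingDist s u
      ≤ (Finset.range i).card := by
        refine Finset.card_le_card_of_injOn (fun j : Fin d => (j : ℕ)) (fun j hj => ?_)
          Fin.val_injective.injOn
        have hne : s j ≠ u j := by simpa using hj
        have hlt : (j : ℕ) < i := by
          by_contra hij
          exact hne (h j (not_lt.mp hij)).symm
        simpa using hlt
    _ = i := Finset.card_range i

/-- At most `|B| * |α| ^ (d - k)` strings of length `d` share their first `k` coordinates with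
some element of `B`. -/
theorem card_agreeing_on_prefix_le {α : Type*} [Fintype α] {d : ℕ} (k : ℕ)
    (B : Finset (Fin d → α)) :
    Nat.card {t : Fin d → α // ∃ u ∈ B, ∀ j : Fin d, (j : ℕ) < k → u j = t j} ≤
      B.card * Fintype.card α ^ (d - k) := by
  classical
  let extend : (Fin d → α) × (Fin (d - k) → α) → Fin d → α := fun p j =>
    if h : (j : ℕ) < k then p.1 j else p.2 ⟨j - k, by omega⟩
  let E := (B ×ˢ (Finset.univ : Finset (Fin (d - k) → α))).image extend
  have hsub : {t : Fin d → α | ∃ u ∈ B, ∀ j : Fin d, (j : ℕ) < k → u j = t j} ⊆ E := by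
    rintro t ⟨u, hu, hut⟩
    refine Finset.mem_coe.mpr (Finset.mem_image.mpr
      ⟨(u, fun m => t ⟨k + m, by omega⟩), by simp [hu], funext fun j => ?_⟩)
    by_cases hj : (j : ℕ) < k
    · simp [extend, hj, hut j hj]
    · have hkj : k + ((j : ℕ) - k) = j := by omega
      simp [extend, hj, hkj]
  calc _ ≤ Nat.card E := Nat.card_mono E.finite_toSet hsub
    _ = E.card := by simp
    _ ≤ (B ×ˢ (Finset.univ : Finset (Fin (d - k) → α))).card := Finset.card_image_le
    _ = B.card * Fintype.card α ^ (d - k) := by simp [Finset.card_product]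

/-- If every u ∈ B has Hamming distance at least k from s, then the
number of strings t whose bit-fixing path from s passes through some element of B is
at most |B| · 2^{d−k}. -/
theorem stmt_8 (d k : ℕ) (s : Fin d → Bool) (B : Finset (Fin d → Bool))
    (hB : ∀ u ∈ B, k ≤ hammingDist s u) :
    Nat.card {t : Fin d → Bool //
        ∃ u ∈ B, ∃ i : ℕ, i ≤ d ∧ ∀ j : Fin d,
          ((j : ℕ) < i → u j = t j) ∧ (i ≤ (j : ℕ) → u j = s j)} ≤
      B.card * 2 ^ (d - k) := by
  refine le_trans (Nat.card_mono (Set.toFinite _) ?_)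
    ((card_agreeing_on_prefix_le k B).trans_eq (by rw [Fintype.card_bool]))
  rintro t ⟨u, hu, i, -, h⟩
  have hki : k ≤ i := (hB u hu).trans (hammingDist_le_of_eq_above fun j => (h j).2)
  exact ⟨u, hu, fun j hj => (h j).1 (hj.trans_le hki)⟩
end

section
/- Let K be a field, let k < n, let v_1, …, v_k ∈ K^n be linearly independent, and let w ∈ K^n. Then there exists a vector w' ∈ K^n differing from w in at most one coordinate such that v_1, …, v_k, w' are linearly independent. -/
/-- A submodule containing every one-coordinate modification of a vector is the whole space. -/
theorem Submodule.eq_top_of_forall_update_mem {R ι : Type*} [Ring R] [Finite ι] [DecidableEq ι]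
    {S : Submodule R (ι → R)} {w : ι → R} (h : ∀ j c, Function.update w j c ∈ S) : S = ⊤ := by
  rw [eq_top_iff, ← (Pi.basisFun R ι).span_eq, Submodule.span_le]
  rintro _ ⟨j, rfl⟩
  suffices Pi.basisFun R ι j = Function.update w j (w j + 1) - Function.update w j (w j) by
    rw [this]
    exact S.sub_mem (h j _) (h j _)
  ext i
  rcases eq_or_ne i j with rfl | hij
  · simp
  · simp [hij]


/-- Given linearly independent v_1, …, v_k ∈ K^n with k < n and any
w ∈ K^n, there is a vector w' differing from w in at most one coordinate such that
v_1, …, v_k, w' are linearly independent. -/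
theorem stmt_13 (K : Type) [Field K] (n k : ℕ) (hk : k < n)
    (v : Fin k → (Fin n → K)) (hv : LinearIndependent K v) (w : Fin n → K) :
    ∃ (j : Fin n) (c : K),
      LinearIndependent K (Fin.snoc v (Function.update w j c)) := by
  by_contra! h
  have htop : Submodule.span K (Set.range v) = ⊤ :=
    Submodule.eq_top_of_forall_update_mem (w := w) fun j c => by
      by_contra hmem
      exact h j c (linearIndependent_finSnoc.2 ⟨hv, hmem⟩)
  have hcard := finrank_span_eq_card hv
  rw [htop, finrank_top, Module.finrank_fin_fun, Fintype.card_fin] at hcard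
  exact hk.ne' hcard
end

section
/- Let K be a field, let A ∈ K^{n×n}, and let i ≤ n be such that the first n − i columns of A are linearly independent. Then there exists an invertible matrix B ∈ K^{n×n} that agrees with A in all but at most i entries, each of which lies in one of the last i columns of A. -/
/-- A vector can be moved out of a proper subspace of `ι → K` by changing at most one entry. -/
theorem exists_notMem_of_ne_top {K ι : Type*} [Field K] [Finite ι]
    {W : Submodule K (ι → K)} (hW : W ≠ ⊤) (x : ι → K) :
    ∃ y, y ∉ W ∧ {r | y r ≠ x r}.Subsingleton := by
  classical
  have := Fintype.ofFinite ι
  by_cases hx : x ∈ W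
  · obtain ⟨r, hr⟩ : ∃ r, Pi.single r (1 : K) ∉ W := by
      by_contra! h
      refine hW (top_le_iff.mp ?_)
      rw [← (Pi.basisFun K ι).span_eq, Submodule.span_le]
      rintro _ ⟨r, rfl⟩
      simpa using h r
    refine ⟨x + Pi.single r 1, fun h => hr ((W.add_mem_iff_right hx).mp h), ?_⟩
    have key : ∀ s, (x + Pi.single r 1 : ι → K) s ≠ x s → s = r := by
      intro s hs
      by_contra hsr
      exact hs (by simp [hsr])
    exact fun s hs t ht => (key s hs).trans (key t ht).symm
  · exact ⟨x, hx, by simp⟩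

/-- Fewer than `|ι|` vectors do not span `ι → K`. -/
theorem span_image_ne_top {K ι : Type*} [Field K] [Finite ι]
    (v : ι → ι → K) {S : Set ι} {j : ι} (hj : j ∉ S) :
    Submodule.span K (v '' S) ≠ ⊤ := by
  classical
  have := Fintype.ofFinite ι
  intro h
  have hle := finrank_range_le_card (R := K) (fun s : S => v s)
  rw [Set.finrank, ← Set.image_eq_range, h, finrank_top, Module.finrank_fintype_fun_eq_card] at hle
  exact absurd (Fintype.card_subtype_lt (p := (· ∈ S)) hj) (not_lt.mpr hle)

/-- A linearly independent subfamily of `v` can be enlarged by the indices in `T`, at the cost of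
changing at most one entry of each of the vectors indexed by `T`. -/
theorem exists_linearIndepOn_union {K ι : Type*} [Field K] [Finite ι]
    (v : ι → ι → K) {S : Set ι} (hv : LinearIndepOn K v S) (T : Finset ι)
    (hST : Disjoint S (T : Set ι)) :
    ∃ w : ι → ι → K, LinearIndepOn K w (S ∪ T) ∧
      (∀ j, {r | w j r ≠ v j r}.Subsingleton) ∧ ∀ j ∉ T, w j = v j := by
  classical
  induction T using Finset.induction_on with
  | empty => exact ⟨v, by simpa using hv, by simp, by simp⟩
  | insert j T hjT ih =>
    rw [Finset.coe_insert, Set.disjoint_insert_right] at hST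
    obtain ⟨w, hw, hsub, heq⟩ := ih hST.2
    have hj : j ∉ S ∪ (T : Set ι) := by simp [hST.1, hjT]
    obtain ⟨y, hy, hyv⟩ := exists_notMem_of_ne_top (span_image_ne_top w hj) (v j)
    have hEq : Set.EqOn w (Function.update w j y) (S ∪ T) := fun k hk =>
      (Function.update_of_ne (ne_of_mem_of_not_mem hk hj) _ _).symm
    refine ⟨Function.update w j y, ?_, fun k => ?_, fun k hk => ?_⟩
    · rw [Finset.coe_insert, Set.union_insert, linearIndepOn_insert hj, Function.update_self,
        ← hEq.image_eq]
      exact ⟨hw.congr hEq, hy⟩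
    · obtain rfl | hk := eq_or_ne k j
      · simpa using hyv
      · simpa [hk] using hsub k
    · rw [Finset.mem_insert, not_or] at hk
      rw [Function.update_of_ne hk.1, heq k hk.2]

/-- If the first n − i columns of A ∈ K^{n×n} are linearly independent,
then there is an invertible B agreeing with A in all but at most i entries, each of
which lies in one of the last i columns. -/
theorem stmt_14 (K : Type) [Field K] (n i : ℕ) (hi : i ≤ n)
    (A : Matrix (Fin n) (Fin n) K)
    (hA : LinearIndependent K
      (fun k : Fin (n - i) => fun r : Fin n => A r (Fin.castLE (Nat.sub_le n i) k))) :
    ∃ B : Matrix (Fin n) (Fin n) K, IsUnit B ∧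
      Nat.card {p : Fin n × Fin n // B p.1 p.2 ≠ A p.1 p.2} ≤ i ∧
      ∀ p : Fin n × Fin n, B p.1 p.2 ≠ A p.1 p.2 → n - i ≤ (p.2 : ℕ) := by
  classical
  have hS : LinearIndepOn K A.col {j : Fin n | (j : ℕ) < n - i} := by
    have hinj : Function.Injective
        (fun j : {j : Fin n | (j : ℕ) < n - i} => (⟨j.1, j.2⟩ : Fin (n - i))) := by
      intro a b h
      exact Subtype.ext (Fin.ext (by simpa using h))
    exact hA.comp _ hinj
  let T : Finset (Fin n) := Finset.univ.filter fun j => n - i ≤ (j : ℕ)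
  have hT : T.card ≤ i := by
    have h := Finset.card_le_card_of_injOn (s := T) (t := Finset.Ico (n - i) n)
      (fun j => (j : ℕ)) (fun j hj => by simpa [T] using hj) Fin.val_injective.injOn
    rw [Nat.card_Ico] at h
    omega
  obtain ⟨w, hw, hsub, heq⟩ := exists_linearIndepOn_union A.col hS T
    (Set.disjoint_left.mpr fun j hj hj' => by
      simp only [T, Finset.coe_filter, Finset.mem_univ, true_and, Set.mem_ofPred_eq] at hj hj'
      omega)
  have huniv : {j : Fin n | (j : ℕ) < n - i} ∪ (T : Set (Fin n)) = Set.univ := by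
    ext j
    simpa [T] using lt_or_ge (j : ℕ) (n - i)
  rw [huniv, linearIndepOn_univ_iff] at hw
  have hmem : ∀ p : Fin n × Fin n, w p.2 p.1 ≠ A p.1 p.2 → p.2 ∈ T := fun p hp => by
    by_contra h
    exact hp (congrFun (heq p.2 h) p.1)
  refine ⟨fun r j => w j r, Matrix.linearIndependent_cols_iff_isUnit.mp hw, ?_,
    fun p hp => by simpa [T] using hmem p hp⟩
  refine le_trans ?_ hT
  rw [← Fintype.card_coe T, ← Nat.card_eq_fintype_card]
  refine Nat.card_le_card_of_injective
    (fun p : {p : Fin n × Fin n // w p.2 p.1 ≠ A p.1 p.2} => (⟨p.1.2, hmem p.1 p.2⟩ : T)) ?_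
  rintro ⟨⟨r, j⟩, hp⟩ ⟨⟨s, k⟩, hq⟩ h
  obtain rfl : j = k := by simpa using h
  obtain rfl : r = s := hsub j hp hq
  rfl
end

section
/- For every constant c > 0 there exists a constant C > 0 such that the following holds for every d ≥ 1 and every permutation f of {0,1}^d. For a, b ∈ {0,1}^d, let P(a,b) denote the bit-fixing path from a to b (the sequence of d+1 vertices obtained from a by replacing, for i = 1,…,d in increasing order of coordinate index, the first i coordinates of a by those of b), and for a, b, c' ∈ {0,1}^d let N(a, b, c') denote the multiset of all vertices occurring on P(a,b) together with all vertices occurring on P(b,c'). Let r : {0,1}^d → {0,1}^d be chosen uniformly at random among all functions from {0,1}^d to {0,1}^d, and let S be the multiset union over all v ∈ {0,1}^d of N(v, r(v), f(v)). Then with probability at least 1 − C·d^{−c} over the choice of r, every element of {0,1}^d occurs in S at most C·d² times. -/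
open Finset in
/-- A Chernoff-type count: if the expected number of `a` for which a uniformly random
`r : α → β` satisfies `A a (r a)` is at most `1`, then the proportion of the `r` with more than
`t` such `a` is at most `exp 1 / 2 ^ t`. -/
theorem card_lt_card_filter_mul_two_rpow_le {α β : Type*} [Fintype α] [DecidableEq α] [Fintype β]
    [Nonempty β] (A : α → β → Prop) [∀ a b, Decidable (A a b)]
    (hA : ∑ a, #{b | A a b} ≤ Fintype.card β) (t : ℝ) :
    (Nat.card {r : α → β // t < (#{a | A a (r a)} : ℝ)} : ℝ) * 2 ^ t ≤
      Real.exp 1 * Nat.card (α → β) := by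
  classical
  have hN : (0 : ℝ) < Fintype.card β := by exact_mod_cast Fintype.card_pos
  have hpow (r : α → β) :
      (2 : ℝ) ^ #{a | A a (r a)} = ∏ a, if A a (r a) then (2 : ℝ) else 1 := by
    rw [Finset.prod_ite]
    simp
  have hfactor (a : α) : ∑ b, (if A a b then (2 : ℝ) else 1) =
      Fintype.card β * (#{b | A a b} / Fintype.card β + 1) := by
    have h (b : β) : (if A a b then (2 : ℝ) else 1) = (if A a b then 1 else 0) + 1 := by
      split_ifs <;> norm_num
    simp only [h, Finset.sum_add_distrib, Finset.sum_boole]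
    field_simp
    simp
  have hmoment : ∑ r : α → β, (2 : ℝ) ^ #{a | A a (r a)} ≤
      Real.exp 1 * Nat.card (α → β) := by
    simp only [hpow]
    rw [← Fintype.prod_sum (fun a b => if A a b then (2 : ℝ) else 1)]
    simp only [hfactor]
    rw [Finset.prod_mul_distrib, mul_comm]
    have hcard : (Nat.card (α → β) : ℝ) = ∏ _a : α, (Fintype.card β : ℝ) := by
      simp
    rw [hcard]
    refine mul_le_mul_of_nonneg_right ?_ (by positivity)
    calc ∏ a, ((#{b | A a b} : ℝ) / Fintype.card β + 1)
        ≤ ∏ a, Real.exp ((#{b | A a b} : ℝ) / Fintype.card β) :=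
          Finset.prod_le_prod (fun _ _ => by positivity) fun _ _ => Real.add_one_le_exp _
      _ = Real.exp ((∑ a, (#{b | A a b} : ℝ)) / Fintype.card β) := by
          rw [← Real.exp_sum, Finset.sum_div]
      _ ≤ Real.exp 1 := by
          rw [Real.exp_le_exp, div_le_one hN]
          exact_mod_cast hA
  refine le_trans ?_ hmoment
  rw [Nat.card_eq_fintype_card, Fintype.card_subtype, ← nsmul_eq_mul]
  refine (Finset.card_nsmul_le_sum _ (fun r => (2 : ℝ) ^ #{a | A a (r a)}) _ fun r hr => ?_).trans
    (Finset.sum_le_univ_sum_of_nonneg fun _ => by positivity)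
  rw [← Real.rpow_natCast]
  exact Real.rpow_le_rpow_of_exponent_le one_le_two (Finset.mem_filter.1 hr).2.le

open Finset in
/-- The string agreeing with `u` can be spliced from at most `card (Fin d → Bool)` pairs. -/
theorem sum_card_splice_eq_le (d i : ℕ) (u : Fin d → Bool) :
    ∑ v : Fin d → Bool,
      #{x : Fin d → Bool | (fun j : Fin d => if (j : ℕ) < i then x j else v j) = u} ≤
    Fintype.card (Fin d → Bool) := by
  rw [← Finset.card_sigma, ← Finset.card_univ]
  refine Finset.card_le_card_of_injOn
    (fun p j => if (j : ℕ) < i then p.1 j else p.2 j) (fun _ _ => Finset.mem_univ _) ?_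
  rintro ⟨v, x⟩ hp ⟨w, y⟩ hq h
  have hp : (fun j : Fin d => if (j : ℕ) < i then x j else v j) = u := by simpa using hp
  have hq : (fun j : Fin d => if (j : ℕ) < i then y j else w j) = u := by simpa using hq
  have hpq := hp.trans hq.symm
  have hv : v = w := by
    funext j
    have h₁ := congrFun h j
    have h₂ := congrFun hpq j
    by_cases hj : (j : ℕ) < i <;> simp_all
  have hx : x = y := by
    funext j
    have h₁ := congrFun h j
    have h₂ := congrFun hpq j
    by_cases hj : (j : ℕ) < i <;> simp_all
  rw [hv, hx]

open Finset in
/-- The mirror image of `sum_card_splice_eq_le`. -/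
theorem sum_card_splice_eq_le' (d i : ℕ) (u : Fin d → Bool) :
    ∑ v : Fin d → Bool,
      #{x : Fin d → Bool | (fun j : Fin d => if (j : ℕ) < i then v j else x j) = u} ≤
    Fintype.card (Fin d → Bool) := by
  refine le_trans (le_of_eq ?_) (sum_card_splice_eq_le d i u)
  simp only [Finset.card_filter]
  exact Finset.sum_comm


/-- Valiant's randomized routing: For every c > 0 there is C > 0 such
that for every d ≥ 1 and every permutation f of {0,1}^d, if r : {0,1}^d → {0,1}^d is
uniformly random, then with probability at least 1 − C·d^{−c} every vertex u of the
hypercube occurs at most C·d² times in the multiset S of vertices of all bit-fixing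
paths v → r(v) → f(v). The number of occurrences of u on the bit-fixing path from a
to b is the number of i ∈ {0,…,d} for which the hybrid string (b on the first i
coordinates, a on the rest) equals u. -/
theorem stmt_16 :
    ∀ c : ℝ, 0 < c → ∃ C : ℝ, 0 < C ∧
      ∀ d : ℕ, 1 ≤ d → ∀ f : (Fin d → Bool) ≃ (Fin d → Bool),
        (1 - C * (d : ℝ) ^ (-c)) * (Nat.card ((Fin d → Bool) → (Fin d → Bool)) : ℝ) ≤
          (Nat.card {r : (Fin d → Bool) → (Fin d → Bool) //
            ∀ u : Fin d → Bool,
              ((∑ v : Fin d → Bool,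
                (((Finset.range (d + 1)).filter (fun i : ℕ =>
                    (fun j : Fin d => if (j : ℕ) < i then r v j else v j) = u)).card +
                 ((Finset.range (d + 1)).filter (fun i : ℕ =>
                    (fun j : Fin d => if (j : ℕ) < i then f v j else r v j) = u)).card) : ℕ) : ℝ)
                ≤ C * (d : ℝ) ^ 2} : ℝ) := by
  intro c hc
  refine ⟨4 * (c + 2) + 12, by positivity, fun d hd f => ?_⟩
  classical
  let V := Fin d → Bool
  have hd1 : (1 : ℝ) ≤ d := by exact_mod_cast hd
  set t : ℝ := (c + 2) * d with ht
  obtain ⟨A, hA_def⟩ : ∃ A : ℕ → V → V → V → Prop, A = fun i u v x => (fun j : Fin d => if (j : ℕ) < i then x j else v j) = u :=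
    ⟨_, rfl⟩
  obtain ⟨B, hB_def⟩ : ∃ B : ℕ → V → V → V → Prop, B = fun i u v x => (fun j : Fin d => if (j : ℕ) < i then f v j else x j) = u :=
    ⟨_, rfl⟩
  let bad (P : V → V → Prop) : Finset (V → V) :=
    Finset.univ.filter fun r => t < ((Finset.univ.filter fun v => P v (r v)).card : ℝ)
  have hbad (P : V → V → Prop)
      (hP : ∑ v, (Finset.univ.filter fun x => P v x).card ≤ Fintype.card V) :
      ((bad P).card : ℝ) ≤ Real.exp 1 * Nat.card (V → V) / 2 ^ t := by
    rw [le_div_iff₀ (by positivity)]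
    have h := card_lt_card_filter_mul_two_rpow_le P hP t
    rwa [Nat.card_eq_fintype_card, Fintype.card_subtype] at h
  have hbadA (i : ℕ) (u : V) := hbad (A i u) (by
    subst hA_def; convert sum_card_splice_eq_le d i u)
  have hbadB (i : ℕ) (u : V) := hbad (B i u) <| by
    have h := sum_card_splice_eq_le' d i u
    rw [← Equiv.sum_comp f] at h
    subst hB_def
    convert h
  let allBad : Finset (V → V) := (Finset.range (d + 1) ×ˢ Finset.univ).biUnion
    fun p : ℕ × V => bad (A p.1 p.2) ∪ bad (B p.1 p.2)
  have hallBad : (allBad.card : ℝ) ≤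
      (4 * (c + 2) + 12) * (d : ℝ) ^ (-c) * Nat.card (V → V) := by
    have h₁ : (allBad.card : ℝ) ≤ ((d + 1 : ℝ) * 2 ^ d) *
        (2 * (Real.exp 1 * Nat.card (V → V) / 2 ^ t)) := by
      have h := Finset.card_biUnion_le (s := Finset.range (d + 1) ×ˢ Finset.univ)
        (t := fun p : ℕ × V => bad (A p.1 p.2) ∪ bad (B p.1 p.2))
      have h' : (allBad.card : ℝ) ≤ ∑ p ∈ Finset.range (d + 1) ×ˢ (Finset.univ : Finset V),
          ((bad (A p.1 p.2) ∪ bad (B p.1 p.2)).card : ℝ) := by exact_mod_cast h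
      refine h'.trans ((Finset.sum_le_card_nsmul _ _
        (2 * (Real.exp 1 * Nat.card (V → V) / 2 ^ t)) fun p _ => ?_).trans_eq ?_)
      · have hu : ((bad (A p.1 p.2) ∪ bad (B p.1 p.2)).card : ℝ) ≤
            (bad (A p.1 p.2)).card + (bad (B p.1 p.2)).card := by
          exact_mod_cast Finset.card_union_le _ _
        linarith [hbadA p.1 p.2, hbadB p.1 p.2]
      · rw [nsmul_eq_mul, Finset.card_product, Finset.card_range, Finset.card_univ]
        simp [V]
    have h₂ : (2 : ℝ) ^ t = 2 ^ d * ((2 : ℝ) ^ d) ^ (c + 1) := by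
      rw [← Real.rpow_natCast 2 d, ← Real.rpow_mul (by norm_num), ← Real.rpow_add (by norm_num)]
      congr 1
      rw [ht]
      ring
    have h₃ : (d : ℝ) ^ c * d ≤ ((2 : ℝ) ^ d) ^ (c + 1) := by
      rw [← Real.rpow_add_one (by positivity)]
      exact Real.rpow_le_rpow (by positivity) (by exact_mod_cast Nat.lt_two_pow_self.le)
        (by positivity)
    have hdc : (0 : ℝ) < (d : ℝ) ^ c := Real.rpow_pos_of_pos (by linarith) c
    refine h₁.trans ?_
    rw [h₂, Real.rpow_neg (by positivity)]
    calc ((d + 1 : ℝ) * 2 ^ d) *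
          (2 * (Real.exp 1 * Nat.card (V → V) / (2 ^ d * ((2 : ℝ) ^ d) ^ (c + 1))))
        = 2 * (d + 1) * Real.exp 1 * Nat.card (V → V) / ((2 : ℝ) ^ d) ^ (c + 1) := by
          field_simp
      _ ≤ 2 * (d + d) * 3 * Nat.card (V → V) / ((d : ℝ) ^ c * d) := by
          gcongr
          exact Real.exp_one_lt_three.le
      _ = 12 * ((d : ℝ) ^ c)⁻¹ * Nat.card (V → V) := by
          field_simp
          ring
      _ ≤ (4 * (c + 2) + 12) * ((d : ℝ) ^ c)⁻¹ * Nat.card (V → V) := by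
          gcongr
          linarith
  have hcompl : (Nat.card (V → V) : ℝ) = allBad.card + (allBadᶜ).card := by
    rw [Nat.card_eq_fintype_card]
    exact_mod_cast (Finset.card_add_card_compl allBad).symm
  rw [Nat.card_eq_fintype_card (α := {r : V → V // _}), Fintype.card_subtype]
  suffices h : ((allBadᶜ).card : ℝ) ≤ _ from le_trans (by linarith) h
  refine Nat.cast_le.2 (Finset.card_le_card fun r hr => ?_)
  rw [Finset.mem_filter]
  refine ⟨Finset.mem_univ _, fun u => ?_⟩
  have hr' (i : ℕ) (hi : i ∈ Finset.range (d + 1)) :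
      ((Finset.univ.filter fun v => A i u v (r v)).card : ℝ) ≤ t ∧
      ((Finset.univ.filter fun v => B i u v (r v)).card : ℝ) ≤ t := by
    rw [Finset.mem_compl, Finset.mem_biUnion] at hr
    have h : r ∉ bad (A i u) ∪ bad (B i u) := fun h =>
      hr ⟨(i, u), Finset.mem_product.2 ⟨hi, Finset.mem_univ _⟩, h⟩
    rw [Finset.mem_union, not_or] at h
    exact ⟨not_lt.1 fun h' => h.1 (Finset.mem_filter.2 ⟨Finset.mem_univ _, h'⟩),
      not_lt.1 fun h' => h.2 (Finset.mem_filter.2 ⟨Finset.mem_univ _, h'⟩)⟩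
  have hswap (P : V → V → ℕ → Prop) :
      ∑ v, ((Finset.range (d + 1)).filter fun i => P v (r v) i).card =
        ∑ i ∈ Finset.range (d + 1), (Finset.univ.filter fun v => P v (r v) i).card := by
    simp only [Finset.card_filter]
    exact Finset.sum_comm
  have hA := hswap fun v x i => A i u v x
  have hB := hswap fun v x i => B i u v x
  have hsum : ((∑ i ∈ Finset.range (d + 1), ((Finset.univ.filter fun v => A i u v (r v)).card +
      (Finset.univ.filter fun v => B i u v (r v)).card) : ℕ) : ℝ) ≤
      (4 * (c + 2) + 12) * (d : ℝ) ^ 2 := by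
    push_cast
    refine (Finset.sum_le_card_nsmul _ _ (2 * t) fun i hi => ?_).trans ?_
    · linarith [(hr' i hi).1, (hr' i hi).2]
    · rw [nsmul_eq_mul, Finset.card_range, ht]
      push_cast
      nlinarith [mul_nonneg (mul_nonneg (by linarith : (0 : ℝ) ≤ c + 2)
        (by linarith : (0 : ℝ) ≤ d)) (by linarith : (0 : ℝ) ≤ (d : ℝ) - 1), sq_nonneg (d : ℝ)]
  rw [Finset.sum_add_distrib, ← hA, ← hB, ← Finset.sum_add_distrib] at hsum
  subst hA_def hB_def
  convert hsum
end
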